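/- arXiv:1411.2024 — 2 statements merged into one kernel-verified Lean document; each statement's English description precedes it below -/
import Mathlib

section
/- For the random walk on the infinite k-ary tree (k ≥ 2), the Green function of the walk killed just before the first positive return to the root ∅ satisfies: for nonempty vertices x, y whose last common ancestor z is at depth j ≥ 1 and y at depth p, G_∅(x,y) = 2(k^j − 1)/(k^{p−1}(k−1)); G_∅(x,y) = 0 if the last common ancestor is ∅; G_∅(∅,y) = 2/k^p for y at depth p ≥ 1; and G_∅(∅,∅) = 1. -/
open MeasureTheory ENNReal
open scoped Classical NNReal

/-- Lists over a countable type, with the discrete σ-algebra. -/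
instance (priority := low) {α : Type*} : MeasurableSpace (List α) := ⊤

/-- A (time-homogeneous) Markov chain on a state space `E`, given by its
transition probabilities `p` and the family of path-space laws `P x` (the chain started
at `x`), characterized by its finite-dimensional distributions. -/
structure MC (E : Type*) [MeasurableSpace E] where
  p : E → E → ℝ≥0∞
  P : E → Measure (ℕ → E)
  prob : ∀ x, IsProbabilityMeasure (P x)
  stochastic : ∀ x, ∑' y, p x y = 1
  fdd : ∀ (x : E) (n : ℕ) (xs : Fin (n + 1) → E),
    P x {ω | ∀ i : Fin (n + 1), ω i = xs i}
      = (if xs 0 = x then 1 else 0) * ∏ i : Fin n, p (xs i.castSucc) (xs i.succ)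

/-- Irreducibility: every state is reachable from every state with positive probability. -/
def MC.Irreducible {E : Type*} [MeasurableSpace E] (M : MC E) : Prop :=
  ∀ x y : E, ∃ n : ℕ, 0 < M.P x {ω | ω n = y}

/-- Recurrence: started from any state, the chain returns to that state infinitely often
almost surely. -/
def MC.Recurrent {E : Type*} [MeasurableSpace E] (M : MC E) : Prop :=
  ∀ x : E, M.P x {ω | ∀ N : ℕ, ∃ n, N ≤ n ∧ ω n = x} = 1

/-- Green function of the chain killed just before the first return time `T'_{x0}`:
`G_{x0}(x,y) = E_x[L^y_{T'_{x0} - 1}]`, the expected number of visits to `y` at times `n`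
such that `x0` has not been visited at any time `1 ≤ k ≤ n`. -/
noncomputable def MC.green {E : Type*} [MeasurableSpace E] (M : MC E) (x0 x y : E) : ℝ≥0∞ :=
  ∫⁻ ω, (∑' n : ℕ, if ω n = y ∧ ∀ k, 1 ≤ k → k ≤ n → ω k ≠ x0 then (1 : ℝ≥0∞) else 0) ∂ M.P x

/-- Transition probabilities of the random walk on the infinite `k`-ary tree, vertices
being finite sequences over `Fin k`: from the root `[]` to each child with probability
`1/k`; from a nonempty vertex to its father with probability `1/2` and to each of its `k`
children with probability `1/(2k)`. -/
noncomputable def treeP (k : ℕ) : List (Fin k) → List (Fin k) → ℝ≥0∞ := fun x y =>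
  if x = [] then (if y.length = 1 then ((k : ℝ≥0∞))⁻¹ else 0)
  else if y = x.dropLast then (1 : ℝ≥0∞) / 2
  else if ∃ j : Fin k, y = x ++ [j] then ((2 * k : ℝ≥0∞))⁻¹
  else 0

/-- Length of the longest common prefix of two lists. -/
def commonLen {α : Type*} [DecidableEq α] : List α → List α → ℕ
  | a :: as, b :: bs => if a = b then commonLen as bs + 1 else 0
  | _, _ => 0

section FirstStep

variable {E : Type*}

/-- Paths of `n` steps ending at `y` and avoiding `x0` at all positive times. -/
def killedPaths (x0 y : E) (n : ℕ) : Set (Fin (n + 1) → E) :=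
  {zs | zs (Fin.last n) = y ∧ ∀ i : Fin n, zs i.succ ≠ x0}

lemma cons_mem_killedPaths (x0 y z : E) (n : ℕ) (zs : Fin (n + 1) → E) :
    (Fin.cons z zs : Fin (n + 2) → E) ∈ killedPaths x0 y (n + 1)
      ↔ zs 0 ≠ x0 ∧ zs ∈ killedPaths x0 y n := by
  simp only [killedPaths, Set.mem_ofPred_eq, ← Fin.succ_last, Fin.cons_succ]
  rw [Fin.forall_fin_succ]
  tauto

/-- A function set to zero at `x0`. -/
noncomputable def killAt (x0 : E) (f : E → ℝ≥0∞) (z : E) : ℝ≥0∞ := if z = x0 then 0 else f z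

lemma setOf_killed_eq (x0 y : E) (n : ℕ) :
    {ω : ℕ → E | ω n = y ∧ ∀ k, 1 ≤ k → k ≤ n → ω k ≠ x0}
      = (fun ω (i : Fin (n + 1)) => ω i) ⁻¹' killedPaths x0 y n := by
  ext ω
  simp only [killedPaths, Set.mem_ofPred_eq, Set.mem_preimage, Fin.val_last, Fin.val_succ]
  refine and_congr_right fun _ => ⟨fun h i => h _ (by omega) (by omega), fun h k h1 h2 => ?_⟩
  have := h ⟨k - 1, by omega⟩
  simpa [Nat.sub_add_cancel h1] using this

lemma tsum_killAt {ι : Type*} (p : E → ℝ≥0∞) (x0 : E) (f : ι → E → ℝ≥0∞) :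
    ∑' i, ∑' z, p z * killAt x0 (f i) z = ∑' z, p z * killAt x0 (fun z => ∑' i, f i z) z := by
  rw [ENNReal.tsum_comm]
  refine tsum_congr fun z => ?_
  rw [ENNReal.tsum_mul_left, killAt]
  split_ifs with h <;> simp [killAt, h]

lemma sum_killAt {ι : Type*} (s : Finset ι) (p : E → ℝ≥0∞) (x0 : E) (f : ι → E → ℝ≥0∞) :
    ∑ i ∈ s, ∑' z, p z * killAt x0 (f i) z = ∑' z, p z * killAt x0 (fun z => ∑ i ∈ s, f i z) z := by
  rw [← Summable.tsum_finsetSum fun _ _ => ENNReal.summable]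
  refine tsum_congr fun z => ?_
  rw [← Finset.mul_sum, killAt]
  split_ifs with h <;> simp [killAt, h]

variable [MeasurableSpace E]

/-- The probability of being at `y` at time `n` without visiting `x0` at times `1, …, n`. -/
noncomputable def MC.killed (M : MC E) (x0 y : E) (n : ℕ) (x : E) : ℝ≥0∞ :=
  M.P x {ω | ω n = y ∧ ∀ k, 1 ≤ k → k ≤ n → ω k ≠ x0}

lemma MC.killed_zero (M : MC E) (x0 y x : E) :
    M.killed x0 y 0 x = if x = y then 1 else 0 := by
  have h := M.fdd x 0 (fun _ => y)
  simp only [Finset.univ_eq_empty, Finset.prod_empty, mul_one] at h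
  have : {ω : ℕ → E | ω 0 = y ∧ ∀ k, 1 ≤ k → k ≤ 0 → ω k ≠ x0} =
      {ω | ∀ i : Fin (0 + 1), ω i = y} := by
    ext ω
    refine ⟨fun h i => ?_, fun h => ⟨h 0, fun k h1 h2 => by omega⟩⟩
    rw [Fin.eq_zero (show Fin 1 from i)]
    exact h.1
  rw [MC.killed, this, h]
  simp only [eq_comm]

variable [Countable E] [MeasurableSingletonClass E]

lemma measurableSet_killed (x0 y : E) (n : ℕ) :
    MeasurableSet {ω : ℕ → E | ω n = y ∧ ∀ k, 1 ≤ k → k ≤ n → ω k ≠ x0} := by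
  rw [setOf_killed_eq]
  exact (measurable_pi_lambda _ fun i => measurable_pi_apply _) (Set.to_countable _).measurableSet

lemma MC.killed_eq_tsum (M : MC E) (x0 y : E) (n : ℕ) (x : E) :
    M.killed x0 y n x = ∑' zs : Fin (n + 1) → E, if zs ∈ killedPaths x0 y n then
      (if zs 0 = x then 1 else 0) * ∏ i : Fin n, M.p (zs i.castSucc) (zs i.succ) else 0 := by
  have hm : Measurable (fun (ω : ℕ → E) (i : Fin (n + 1)) => ω i) :=
    measurable_pi_lambda _ fun i => measurable_pi_apply _
  rw [MC.killed, setOf_killed_eq, ← tsum_measure_preimage_singleton (Set.to_countable _)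
    (fun zs _ => hm (measurableSet_singleton zs)), tsum_subtype (killedPaths x0 y n)
    (fun zs => M.P x ((fun (ω : ℕ → E) (i : Fin (n + 1)) => ω i) ⁻¹' {zs}))]
  refine tsum_congr fun zs => ?_
  rw [Set.indicator_apply, ← M.fdd]
  simp only [Set.preimage, Set.mem_singleton_iff, funext_iff]

lemma MC.killed_succ (M : MC E) (x0 y : E) (n : ℕ) (x : E) :
    M.killed x0 y (n + 1) x = ∑' z, M.p x z * killAt x0 (M.killed x0 y n) z := by
  have hR : ∀ z, M.p x z * killAt x0 (M.killed x0 y n) z = ∑' zs : Fin (n + 1) → E,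
      if z = zs 0 then (if zs 0 ≠ x0 ∧ zs ∈ killedPaths x0 y n then
        M.p x (zs 0) * ∏ i : Fin n, M.p (zs i.castSucc) (zs i.succ) else 0) else 0 := by
    intro z
    by_cases hz : z = x0
    · simp only [killAt, hz, if_true, mul_zero]
      refine (ENNReal.tsum_eq_zero.2 fun zs => ?_).symm
      split_ifs <;> tauto
    · rw [killAt, if_neg hz, M.killed_eq_tsum, ← ENNReal.tsum_mul_left]
      refine tsum_congr fun zs => ?_
      by_cases h : z = zs 0
      · subst h; simp [hz]
      · simp [h, Ne.symm h]
  simp_rw [hR]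
  rw [ENNReal.tsum_comm, M.killed_eq_tsum, ← (Fin.consEquiv fun _ => E).tsum_eq,
    ENNReal.tsum_prod', ENNReal.tsum_comm]
  refine tsum_congr fun zs => ?_
  have hmem : ∀ z, (Fin.consEquiv fun _ => E) (z, zs) ∈ killedPaths x0 y (n + 1)
      ↔ zs 0 ≠ x0 ∧ zs ∈ killedPaths x0 y n := fun z => cons_mem_killedPaths x0 y z n zs
  rw [tsum_ite_eq (zs 0) fun _ => if zs 0 ≠ x0 ∧ zs ∈ killedPaths x0 y n then
    M.p x (zs 0) * ∏ i : Fin n, M.p (zs i.castSucc) (zs i.succ) else 0]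
  simp only [hmem, Fin.consEquiv_apply, Fin.cons_zero, Fin.prod_univ_succ,
    Fin.castSucc_zero, Fin.cons_succ, ← Fin.succ_castSucc]
  rw [tsum_eq_single x]
  · simp
  · intro z hz
    simp [hz]

lemma MC.green_eq_tsum_killed (M : MC E) (x0 x y : E) :
    M.green x0 x y = ∑' n, M.killed x0 y n x := by
  have h : ∀ n, Measurable fun ω : ℕ → E =>
      if ω n = y ∧ ∀ k, 1 ≤ k → k ≤ n → ω k ≠ x0 then (1 : ℝ≥0∞) else 0 :=
    fun n => Measurable.ite (measurableSet_killed x0 y n) measurable_const measurable_const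
  rw [MC.green, lintegral_tsum fun n => (h n).aemeasurable]
  refine tsum_congr fun n => ?_
  rw [MC.killed, ← lintegral_indicator_one (measurableSet_killed x0 y n)]
  refine lintegral_congr fun ω => ?_
  rw [Set.indicator_apply]
  congr

/-- First-step decomposition of the killed Green function. -/
lemma MC.green_eq_add (M : MC E) (x0 x y : E) :
    M.green x0 x y
      = (if x = y then 1 else 0) + ∑' z, M.p x z * killAt x0 (fun z => M.green x0 z y) z := by
  simp_rw [M.green_eq_tsum_killed]
  rw [tsum_eq_zero_add' ENNReal.summable, M.killed_zero, ← tsum_killAt]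
  simp_rw [M.killed_succ]

/-- The killed Green function is dominated off `x0` by every nonnegative supersolution. -/
lemma MC.green_le (M : MC E) (x0 y : E) (g : E → ℝ≥0∞)
    (hg : ∀ x ≠ x0, (if x = y then 1 else 0) + ∑' z, M.p x z * killAt x0 g z ≤ g x)
    {x : E} (hx : x ≠ x0) : M.green x0 x y ≤ g x := by
  rw [M.green_eq_tsum_killed, ENNReal.tsum_eq_iSup_nat]
  refine iSup_le fun N => ?_
  induction N generalizing x with
  | zero => simp
  | succ N ih =>
    refine le_trans (le_of_eq ?_) (le_trans (add_le_add_right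
      (ENNReal.tsum_le_tsum fun z => mul_le_mul_right (?_ : killAt x0 (fun z =>
        ∑ n ∈ Finset.range N, M.killed x0 y n z) z ≤ killAt x0 g z) (M.p x z)) _) (hg x hx))
    · rw [Finset.sum_range_succ', M.killed_zero, add_comm]
      congr 1
      rw [← sum_killAt]
      simp_rw [M.killed_succ]
    · unfold killAt
      split_ifs with h
      · exact le_rfl
      · exact ih h

end FirstStep

section CommonLen

variable {α : Type*} [DecidableEq α]

lemma commonLen_nil_left (y : List α) : commonLen [] y = 0 := by
  cases y <;> rfl

lemma commonLen_append_singleton (x y : List α) (i : α) :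
    commonLen (x ++ [i]) y = if x ++ [i] <+: y then x.length + 1 else commonLen x y := by
  induction x generalizing y with
  | nil => cases y <;> simp [commonLen]
  | cons a x ih =>
    cases y with
    | nil => simp [commonLen]
    | cons b y =>
      simp only [List.cons_append, commonLen, ih, List.cons_prefix_cons, List.length_cons]
      split_ifs <;> simp_all

lemma commonLen_of_prefix {x y : List α} (h : x <+: y) : commonLen x y = x.length := by
  induction x using List.reverseRecOn with
  | nil => exact commonLen_nil_left y
  | append_singleton x i ih => simp [commonLen_append_singleton, h]

lemma commonLen_le_right (x y : List α) : commonLen x y ≤ y.length := by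
  induction x generalizing y with
  | nil => simp [commonLen_nil_left]
  | cons a x ih =>
    cases y with
    | nil => simp [commonLen]
    | cons b y =>
      simp only [commonLen, List.length_cons]
      split_ifs
      · exact Nat.succ_le_succ (ih y)
      · omega

end CommonLen

section Tree

variable {k : ℕ}

lemma tsum_treeP_nil (f : List (Fin k) → ℝ≥0∞) :
    ∑' z, treeP k [] z * f z = ∑ i, (k : ℝ≥0∞)⁻¹ * f [i] := by
  have h : ∀ z, treeP k [] z * f z = ∑ i, if z = [i] then (k : ℝ≥0∞)⁻¹ * f [i] else 0 := by
    intro z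
    rcases z with _ | ⟨a, _ | ⟨b, z⟩⟩ <;> simp [treeP]
  simp_rw [h]
  rw [Summable.tsum_finsetSum fun _ _ => ENNReal.summable]
  simp_rw [tsum_ite_eq]

lemma tsum_treeP_append_singleton (x : List (Fin k)) (j : Fin k) (f : List (Fin k) → ℝ≥0∞) :
    ∑' z, treeP k (x ++ [j]) z * f z
      = 1 / 2 * f x + ∑ i, (2 * k : ℝ≥0∞)⁻¹ * f (x ++ [j] ++ [i]) := by
  have h : ∀ z, treeP k (x ++ [j]) z * f z = (if z = x then 1 / 2 * f x else 0)
      + ∑ i, if z = x ++ [j] ++ [i] then (2 * k : ℝ≥0∞)⁻¹ * f (x ++ [j] ++ [i]) else 0 := by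
    intro z
    rw [treeP, if_neg (by simp), List.dropLast_concat]
    by_cases hz : z = x
    · subst hz
      simp
    · rw [if_neg hz, if_neg hz, zero_add]
      by_cases hc : ∃ i, z = x ++ [j] ++ [i]
      · obtain ⟨i, rfl⟩ := hc
        simp
      · rw [if_neg hc, zero_mul, Finset.sum_eq_zero]
        intro i _
        exact if_neg fun hi => hc ⟨i, hi⟩
  simp_rw [h]
  rw [ENNReal.tsum_add, tsum_ite_eq, Summable.tsum_finsetSum fun _ _ => ENNReal.summable]
  simp_rw [tsum_ite_eq]

/-- The explicit killed Green function at `y`, vanishing at the root. -/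
noncomputable def treeGreen (k : ℕ) (y x : List (Fin k)) : ℝ :=
  2 / ((k : ℝ) ^ (y.length - 1) * (k - 1)) * ((k : ℝ) ^ commonLen x y - 1)

lemma treeGreen_nil (y : List (Fin k)) : treeGreen k y [] = 0 := by
  simp [treeGreen, commonLen_nil_left]

lemma treeGreen_nonneg (hk : 2 ≤ k) (y x : List (Fin k)) : 0 ≤ treeGreen k y x := by
  have h : (2 : ℝ) ≤ k := by exact_mod_cast hk
  have h1 : (1 : ℝ) ≤ (k : ℝ) ^ commonLen x y := one_le_pow₀ (by linarith)
  have h2 : (0 : ℝ) ≤ (k : ℝ) - 1 := by linarith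
  have h3 : (0 : ℝ) ≤ (k : ℝ) ^ commonLen x y - 1 := by linarith
  unfold treeGreen
  positivity

lemma treeGreen_le (hk : 2 ≤ k) (y x : List (Fin k)) :
    treeGreen k y x ≤ 2 / ((k : ℝ) ^ (y.length - 1) * (k - 1)) * ((k : ℝ) ^ y.length - 1) := by
  have h : (2 : ℝ) ≤ k := by exact_mod_cast hk
  have h2 : (0 : ℝ) ≤ (k : ℝ) - 1 := by linarith
  unfold treeGreen
  gcongr
  · linarith
  · exact commonLen_le_right x y

lemma treeGreen_append_singleton (hk : 2 ≤ k) (y x : List (Fin k)) (j : Fin k) :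
    treeGreen k y (x ++ [j]) = (if x ++ [j] = y then 1 else 0)
      + (1 / 2 * treeGreen k y x + ∑ i, (2 * k : ℝ)⁻¹ * treeGreen k y (x ++ [j] ++ [i])) := by
  have hk2 : (2 : ℝ) ≤ k := by exact_mod_cast hk
  have hk0 : (k : ℝ) ≠ 0 := by linarith
  have hk1 : (k : ℝ) - 1 ≠ 0 := by linarith
  by_cases hp : x ++ [j] <+: y
  · have hx : commonLen x y = x.length := commonLen_of_prefix ((List.prefix_append _ _).trans hp)
    obtain ⟨_ | ⟨b, t⟩, rfl⟩ := hp
    · simp only [treeGreen, commonLen_append_singleton, hx]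
      simp [List.prefix_append_right_inj]
      field_simp
      ring
    · have hi : ∀ i, treeGreen k (x ++ [j] ++ b :: t) (x ++ [j] ++ [i])
          = treeGreen k (x ++ [j] ++ b :: t) (x ++ [j]) + if i = b then
            2 / ((k : ℝ) ^ ((x ++ [j] ++ b :: t).length - 1) * (k - 1))
              * ((k : ℝ) ^ (x.length + 2) - k ^ (x.length + 1)) else 0 := by
        intro i
        by_cases h : i = b
        · subst h
          simp [treeGreen, commonLen_append_singleton (x ++ [j]),
            commonLen_of_prefix (List.prefix_append (x ++ [j]) _), List.prefix_append_right_inj,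
            -List.append_assoc, List.prefix_cons_iff]
          ring
        · simp [treeGreen, commonLen_append_singleton (x ++ [j]), List.prefix_append_right_inj,
            -List.append_assoc, h]
      simp_rw [hi, ← Finset.mul_sum, Finset.sum_add_distrib]
      simp [treeGreen, hx, commonLen_of_prefix (List.prefix_append (x ++ [j]) _),
        -List.append_assoc]
      field_simp
      ring
  · have hc : ∀ i, ¬ (x ++ [j] ++ [i] <+: y) := fun i h => hp ((List.prefix_append _ _).trans h)
    have hne : x ++ [j] ≠ y := fun h => hp (h ▸ List.prefix_rfl)
    simp only [treeGreen, commonLen_append_singleton, hp, hc, hne, if_false, Finset.sum_const,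
      Finset.card_univ, Fintype.card_fin, nsmul_eq_mul]
    field_simp
    ring

/-- Increments of a harmonic function continue along some ray without decreasing. -/
lemma exists_ray_of_harmonic (hk : 2 ≤ k) (h : List (Fin k) → ℝ)
    (hh : ∀ x j, h (x ++ [j]) = 1 / 2 * h x + ∑ i, (2 * k : ℝ)⁻¹ * h (x ++ [j] ++ [i]))
    (x : List (Fin k)) (j : Fin k) (n : ℕ) :
    ∃ z i, h (x ++ [j]) - h x ≤ h (z ++ [i]) - h z ∧ h x + n * (h (x ++ [j]) - h x) ≤ h z := by
  have hk0 : (0 : ℝ) < k := by exact_mod_cast (by omega : 0 < k)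
  induction n with
  | zero => exact ⟨x, j, le_rfl, by simp⟩
  | succ n ih =>
    obtain ⟨z, i, h1, h2⟩ := ih
    have : ∃ l ∈ Finset.univ, 2 * h (z ++ [i]) - h z ≤ h (z ++ [i] ++ [l]) := by
      apply Finset.exists_le_of_sum_le ⟨j, Finset.mem_univ j⟩
      have := hh z i
      rw [← Finset.mul_sum] at this
      simp only [Finset.sum_const, Finset.card_univ, Fintype.card_fin, nsmul_eq_mul]
      refine le_of_eq ?_
      field_simp at this
      linarith
    obtain ⟨l, -, hl⟩ := this
    refine ⟨z ++ [i], l, by linarith, ?_⟩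
    push_cast
    linarith

/-- Liouville property for functions harmonic off the root and vanishing there. -/
lemma eq_zero_of_harmonic (hk : 2 ≤ k) (h : List (Fin k) → ℝ) (h0 : h [] = 0)
    (hh : ∀ x j, h (x ++ [j]) = 1 / 2 * h x + ∑ i, (2 * k : ℝ)⁻¹ * h (x ++ [j] ++ [i]))
    (hpos : ∀ x, 0 ≤ h x) (C : ℝ) (hC : ∀ x, h x ≤ C) (x : List (Fin k)) : h x = 0 := by
  induction x using List.reverseRecOn with
  | nil => exact h0
  | append_singleton x j ih =>
    by_contra hne
    have hlt : 0 < h (x ++ [j]) := lt_of_le_of_ne (hpos _) (Ne.symm hne)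
    obtain ⟨n, hn⟩ := exists_nat_gt (C / h (x ++ [j]))
    rw [div_lt_iff₀ hlt] at hn
    obtain ⟨z, i, -, hz⟩ := exists_ray_of_harmonic hk h hh x j n
    have := hC z
    rw [ih] at hz
    linarith

lemma ofReal_two_mul_inv (hk : 2 ≤ k) : (2 * k : ℝ≥0∞)⁻¹ = ENNReal.ofReal (2 * k : ℝ)⁻¹ := by
  have : (0 : ℝ) < 2 * k := by positivity
  rw [ENNReal.ofReal_inv_of_pos this, ENNReal.ofReal_mul (by norm_num)]
  simp

lemma killAt_ofReal_treeGreen (y x : List (Fin k)) :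
    killAt [] (fun z => ENNReal.ofReal (treeGreen k y z)) x = ENNReal.ofReal (treeGreen k y x) := by
  unfold killAt
  split_ifs with h
  · simp [h, treeGreen_nil]
  · rfl

lemma MC.green_le_treeGreen (hk : 2 ≤ k) (M : MC (List (Fin k))) (hp : M.p = treeP k)
    (y : List (Fin k)) {x : List (Fin k)} (hx : x ≠ []) :
    M.green [] x y ≤ ENNReal.ofReal (treeGreen k y x) := by
  refine M.green_le [] y (fun z => ENNReal.ofReal (treeGreen k y z)) (fun x hx => ?_) hx
  obtain ⟨x, j, rfl⟩ := (List.eq_nil_or_concat' x).resolve_left hx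
  have hs : ∀ i ∈ Finset.univ, 0 ≤ (2 * k : ℝ)⁻¹ * treeGreen k y (x ++ [j] ++ [i]) :=
    fun i _ => mul_nonneg (by positivity) (treeGreen_nonneg hk _ _)
  have hx0 : 0 ≤ 1 / 2 * treeGreen k y x := mul_nonneg (by norm_num) (treeGreen_nonneg hk _ _)
  rw [hp, tsum_treeP_append_singleton]
  simp only [killAt_ofReal_treeGreen]
  rw [treeGreen_append_singleton hk, ENNReal.ofReal_add (by split_ifs <;> norm_num)
    (add_nonneg hx0 (Finset.sum_nonneg hs)), ENNReal.ofReal_add hx0 (Finset.sum_nonneg hs),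
    ENNReal.ofReal_sum_of_nonneg hs, ENNReal.ofReal_mul (by norm_num)]
  simp_rw [ofReal_two_mul_inv hk, ENNReal.ofReal_mul (by positivity : 0 ≤ (2 * k : ℝ)⁻¹)]
  refine le_of_eq ?_
  congr 2
  · split_ifs <;> simp
  · simp

/-- The killed Green function off the root. -/
lemma MC.green_tree (hk : 2 ≤ k) (M : MC (List (Fin k))) (hp : M.p = treeP k)
    (y : List (Fin k)) {x : List (Fin k)} (hx : x ≠ []) :
    M.green [] x y = ENNReal.ofReal (treeGreen k y x) := by
  set f := killAt [] (fun z => M.green [] z y) with hf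
  have hfle : ∀ z, f z ≤ ENNReal.ofReal (treeGreen k y z) := by
    intro z
    rw [hf, killAt]
    split_ifs with h
    · exact zero_le
    · exact M.green_le_treeGreen hk hp y h
  have hfin : ∀ z, f z ≠ ∞ := fun z => ne_top_of_le_ne_top ENNReal.ofReal_ne_top (hfle z)
  have hf0 : f [] = 0 := if_pos rfl
  have hfeq : ∀ z ≠ [], f z = M.green [] z y := fun z hz => if_neg hz
  have hfrec : ∀ x j, (f (x ++ [j])).toReal = (if x ++ [j] = y then 1 else 0)
      + (1 / 2 * (f x).toReal + ∑ i, (2 * k : ℝ)⁻¹ * (f (x ++ [j] ++ [i])).toReal) := by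
    intro x j
    have hs : ∀ i ∈ Finset.univ, (2 * k : ℝ≥0∞)⁻¹ * f (x ++ [j] ++ [i]) ≠ ∞ := fun i _ => by
      rw [ofReal_two_mul_inv hk]
      exact ENNReal.mul_ne_top ENNReal.ofReal_ne_top (hfin _)
    have h2 : 1 / 2 * f x ≠ ∞ := ENNReal.mul_ne_top (by simp) (hfin _)
    rw [hfeq _ (by simp), M.green_eq_add, ← hf, hp, tsum_treeP_append_singleton,
      ENNReal.toReal_add (by split_ifs <;> simp)
        (ENNReal.add_ne_top.2 ⟨h2, ENNReal.sum_ne_top.2 hs⟩),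
      ENNReal.toReal_add h2 (ENNReal.sum_ne_top.2 hs), ENNReal.toReal_sum hs]
    congr 1
    · split_ifs <;> simp
    · simp
  have key := eq_zero_of_harmonic hk (fun z => treeGreen k y z - (f z).toReal)
    (by simp [hf0, treeGreen_nil])
    (fun x j => by
      simp only [treeGreen_append_singleton hk y x j, hfrec x j, mul_sub, Finset.sum_sub_distrib]
      ring)
    (fun z => sub_nonneg.2 (ENNReal.toReal_le_of_le_ofReal (treeGreen_nonneg hk _ _) (hfle z)))
    _ (fun z => (sub_le_self _ ENNReal.toReal_nonneg).trans (treeGreen_le hk y z)) x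
  rw [← hfeq x hx, sub_eq_zero.1 key, ENNReal.ofReal_toReal (hfin x)]

end Tree

/-- Green function of the random walk on the infinite `k`-ary tree (`k ≥ 2`) killed just
before the first positive return to the root `∅`: for nonempty `x, y` whose last common
ancestor is at depth `j ≥ 1` and `y` at depth `p`, `G_∅(x,y) = 2(k^j − 1)/(k^{p−1}(k−1))`;
`G_∅(x,y) = 0` if the last common ancestor is `∅`; `G_∅(∅,y) = 2/k^p` for `y` at depth
`p ≥ 1`; and `G_∅(∅,∅) = 1`. -/
theorem tree_green_killed
    (k : ℕ) (hk : 2 ≤ k) (M : MC (List (Fin k))) (hp : M.p = treeP k) :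
    (∀ x y : List (Fin k), x ≠ [] → y ≠ [] → 1 ≤ commonLen x y →
      M.green [] x y
        = 2 * ((k : ℝ≥0∞) ^ (commonLen x y) - 1)
            / ((k : ℝ≥0∞) ^ (y.length - 1) * ((k : ℝ≥0∞) - 1))) ∧
    (∀ x y : List (Fin k), x ≠ [] → y ≠ [] → commonLen x y = 0 → M.green [] x y = 0) ∧
    (∀ y : List (Fin k), y ≠ [] → M.green [] [] y = 2 / (k : ℝ≥0∞) ^ y.length) ∧
    M.green [] [] [] = 1 := by
  have hk2 : (2 : ℝ) ≤ k := by exact_mod_cast hk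
  have hk0 : (k : ℝ) ≠ 0 := by linarith
  have hk1 : (0 : ℝ) < (k : ℝ) - 1 := by linarith
  refine ⟨fun x y hx hy _ => ?_, fun x y hx hy h => ?_, fun y hy => ?_, ?_⟩
  · rw [M.green_tree hk hp y hx, treeGreen, div_mul_eq_mul_div, ENNReal.ofReal_div_of_pos
      (by positivity), ENNReal.ofReal_mul (by norm_num), ENNReal.ofReal_mul (by positivity),
      ENNReal.ofReal_sub _ (by norm_num), ENNReal.ofReal_sub _ (by norm_num),
      ENNReal.ofReal_pow (by positivity), ENNReal.ofReal_pow (by positivity)]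
    simp
  · rw [M.green_tree hk hp y hx, treeGreen, h]
    simp
  · obtain ⟨a, t, rfl⟩ := List.exists_cons_of_ne_nil hy
    rw [M.green_eq_add, if_neg (Ne.symm hy), hp, tsum_treeP_nil, zero_add,
      Finset.sum_eq_single a]
    · rw [killAt, if_neg (by simp), M.green_tree hk hp _ (by simp)]
      have hg : treeGreen k (a :: t) [a] = 2 / (k : ℝ) ^ t.length := by
        simp only [treeGreen, commonLen, if_true, List.length_cons]
        simp only [zero_add, pow_one, Nat.add_sub_cancel]
        field_simp
      rw [hg, ENNReal.ofReal_div_of_pos (by positivity), ENNReal.ofReal_pow (by positivity),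
        List.length_cons, pow_succ, div_eq_mul_inv, div_eq_mul_inv,
        ENNReal.mul_inv (by simp) (by simp)]
      simp
      ring
    · intro i _ hi
      rw [killAt, if_neg (by simp), M.green_tree hk hp _ (by simp)]
      simp [treeGreen, commonLen, hi]
    · simp
  · have h0 : ∀ z, killAt [] (fun z => M.green [] z []) z = 0 := by
      intro z
      rw [killAt]
      split_ifs with hz
      · rfl
      · rw [M.green_tree hk hp [] hz]
        have := commonLen_le_right z ([] : List (Fin k))
        rw [List.length_nil, Nat.le_zero] at this
        simp [treeGreen, this]
    rw [M.green_eq_add]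
    simp [h0]
end

section
/- On the infinite k-ary tree, the depth process (length of X_n) of the random walk is a reflected simple symmetric random walk on ℕ₀; consequently the random walk on the tree is recurrent. -/
open MeasureTheory ENNReal
open scoped Classical NNReal

/-- Transition probabilities of the reflected simple symmetric random walk on `ℕ`:
`0 → 1` with probability `1`, and `m → m ± 1` each with probability `1/2` for `m ≥ 1`. -/
noncomputable def reflP : ℕ → ℕ → ℝ≥0∞ := fun x y =>
  if x = 0 then (if y = 1 then 1 else 0)
  else if y = x + 1 ∨ y + 1 = x then (1 : ℝ≥0∞) / 2
  else 0

section PathSpace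

variable {E : Type*}

/-- The paths agreeing with `a` up to time `n`. -/
def pathCylinder (a : ℕ → E) (n : ℕ) : Set (ℕ → E) := {ω | ∀ i ≤ n, ω i = a i}

/-- The initial segment of a path up to time `n`. -/
def pathRestrict (n : ℕ) (ω : ℕ → E) : Fin (n + 1) → E := fun i => ω i

/-- The path seen from time `n` on. -/
def pathShift (n : ℕ) (ω : ℕ → E) : ℕ → E := fun m => ω (n + m)

/-- The paths that visit `y`. -/
def hitSet (y : E) : Set (ℕ → E) := {ω | ∃ n, ω n = y}

theorem pathRestrict_preimage_singleton (n : ℕ) (a : ℕ → E) :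
    pathRestrict n ⁻¹' {pathRestrict n a} = pathCylinder a n := by
  ext ω
  simp only [Set.mem_preimage, Set.mem_singleton_iff, pathCylinder, Set.mem_ofPred_eq,
    funext_iff, pathRestrict]
  exact ⟨fun h i hi => h ⟨i, by omega⟩, fun h i => h i (by omega)⟩

theorem exists_pathRestrict_eq (n : ℕ) (xs : Fin (n + 1) → E) :
    ∃ a : ℕ → E, pathRestrict n a = xs := by
  refine ⟨fun i => xs ⟨min i n, by omega⟩, funext fun i => ?_⟩
  simp only [pathRestrict]
  congr 1
  ext
  simp only
  omega

theorem isPiSystem_pathCylinder :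
    IsPiSystem {s : Set (ℕ → E) | ∃ a n, s = pathCylinder a n} := by
  rintro _ ⟨a, n, rfl⟩ _ ⟨b, m, rfl⟩ ⟨c, hca, hcb⟩
  refine ⟨c, max n m, ?_⟩
  ext ω
  simp only [Set.mem_inter_iff, pathCylinder, Set.mem_ofPred_eq] at *
  constructor
  · rintro ⟨h1, h2⟩ i hi
    rcases le_max_iff.mp hi with h | h
    · rw [h1 i h, hca i h]
    · rw [h2 i h, hcb i h]
  · intro h
    exact ⟨fun i hi => by rw [h i (by omega), hca i hi],
      fun i hi => by rw [h i (by omega), hcb i hi]⟩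

variable [MeasurableSpace E]

theorem measurable_pathRestrict (n : ℕ) : Measurable (pathRestrict (E := E) n) :=
  measurable_pi_lambda _ fun i => measurable_pi_apply (i : ℕ)

theorem measurable_pathShift (n : ℕ) : Measurable (pathShift (E := E) n) :=
  measurable_pi_lambda _ fun m => measurable_pi_apply (n + m)

variable [MeasurableSingletonClass E]

theorem measurableSet_eval_eq (n : ℕ) (y : E) : MeasurableSet {ω : ℕ → E | ω n = y} :=
  (measurable_pi_apply n : Measurable fun ω : ℕ → E => ω n) (measurableSet_singleton y)

theorem measurableSet_hitSet (y : E) :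
    MeasurableSet (hitSet y) := by
  have : hitSet y = ⋃ n : ℕ, (fun ω : ℕ → E => ω n) ⁻¹' {y} := by
    ext ω
    simp [hitSet]
  rw [this]
  exact MeasurableSet.iUnion fun n => measurable_pi_apply n (measurableSet_singleton y)

theorem measurableSet_pathCylinder (a : ℕ → E) (n : ℕ) : MeasurableSet (pathCylinder a n) := by
  rw [← pathRestrict_preimage_singleton]
  exact measurable_pathRestrict n (measurableSet_singleton _)

variable [Countable E]

theorem generateFrom_pathCylinder :
    (MeasurableSpace.pi : MeasurableSpace (ℕ → E)) =
      MeasurableSpace.generateFrom {s | ∃ a n, s = pathCylinder a n} := by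
  apply le_antisymm
  · refine iSup_le fun n => ?_
    rw [← measurable_iff_comap_le]
    have hres : @Measurable _ _
        (MeasurableSpace.generateFrom {s : Set (ℕ → E) | ∃ a n, s = pathCylinder a n}) _
        (pathRestrict n) := by
      refine @measurable_to_countable' _ _ _ _
        (MeasurableSpace.generateFrom _) _ fun xs => ?_
      obtain ⟨a, rfl⟩ := exists_pathRestrict_eq n xs
      rw [pathRestrict_preimage_singleton]
      exact MeasurableSpace.measurableSet_generateFrom ⟨a, n, rfl⟩
    exact (measurable_pi_apply (Fin.last n)).comp hres
  · refine MeasurableSpace.generateFrom_le ?_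
    rintro _ ⟨a, n, rfl⟩
    exact measurableSet_pathCylinder a n

theorem ext_of_pathCylinder {μ ν : Measure (ℕ → E)} [IsFiniteMeasure μ]
    (h : ∀ a n, μ (pathCylinder a n) = ν (pathCylinder a n)) : μ = ν := by
  refine ext_of_generate_finite _ generateFrom_pathCylinder isPiSystem_pathCylinder ?_ ?_
  · rintro _ ⟨a, n, rfl⟩
    exact h a n
  · have key : ∀ ρ : Measure (ℕ → E),
        ρ Set.univ = ∑' b : (Set.univ : Set (Fin 1 → E)), ρ (pathRestrict 0 ⁻¹' {↑b}) := by
      intro ρ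
      rw [tsum_measure_preimage_singleton Set.countable_univ
        fun y _ => measurable_pathRestrict 0 (measurableSet_singleton y), Set.preimage_univ]
    rw [key μ, key ν]
    refine tsum_congr fun b => ?_
    obtain ⟨a, ha⟩ := exists_pathRestrict_eq 0 b.1
    rw [← ha, pathRestrict_preimage_singleton, h]

end PathSpace

namespace MC

section General

variable {E : Type*} [MeasurableSpace E] (M : MC E)

theorem measure_pathCylinder (x : E) (a : ℕ → E) (n : ℕ) :
    M.P x (pathCylinder a n) =
      (if a 0 = x then 1 else 0) * ∏ i ∈ Finset.range n, M.p (a i) (a (i + 1)) := by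
  have h := M.fdd x n (pathRestrict n a)
  have hset : {ω : ℕ → E | ∀ i : Fin (n + 1), ω i = pathRestrict n a i} = pathCylinder a n := by
    rw [← pathRestrict_preimage_singleton]
    ext ω
    simp [funext_iff, pathRestrict]
  rw [hset] at h
  rw [h, Finset.prod_range]
  rfl

theorem measure_eval_zero (x : E) : M.P x {ω | ω 0 = x} = 1 := by
  have h := M.measure_pathCylinder x (fun _ => x) 0
  simpa [pathCylinder] using h

theorem measure_hitSet_self (y : E) : M.P y (hitSet y) = 1 := by
  have := M.prob
  refine le_antisymm prob_le_one ?_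
  rw [← M.measure_eval_zero y]
  exact measure_mono fun ω hω => ⟨0, hω⟩

variable [MeasurableSingletonClass E]

theorem ae_eval_zero (x : E) : ∀ᵐ ω ∂(M.P x), ω 0 = x := by
  have := M.prob
  exact (prob_compl_eq_zero_iff (measurableSet_eval_eq 0 x)).mpr (M.measure_eval_zero x)

variable [Countable E]

theorem measure_pathCylinder_inter_shift (x : E) (a : ℕ → E) (n : ℕ) {B : Set (ℕ → E)}
    (hB : MeasurableSet B) :
    M.P x (pathCylinder a n ∩ pathShift n ⁻¹' B) =
      M.P x (pathCylinder a n) * M.P (a n) B := by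
  have := M.prob
  have hμ : ((M.P x).restrict (pathCylinder a n)).map (pathShift n) =
      M.P x (pathCylinder a n) • M.P (a n) := by
    refine ext_of_pathCylinder fun b m => ?_
    rw [Measure.map_apply (measurable_pathShift n) (measurableSet_pathCylinder b m),
      Measure.restrict_apply (measurable_pathShift n (measurableSet_pathCylinder b m)),
      Measure.smul_apply, smul_eq_mul, M.measure_pathCylinder (a n) b m]
    by_cases hb : b 0 = a n
    · set c : ℕ → E := fun i => if i ≤ n then a i else b (i - n) with hc
      have hca : ∀ i ≤ n, c i = a i := fun i hi => by simp [hc, hi]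
      have hcb : ∀ i, c (n + i) = b i := by
        intro i
        rcases Nat.eq_zero_or_pos i with rfl | hi
        · simp [hc, hb]
        · simp [hc, hi.ne']
      have hset : pathShift n ⁻¹' pathCylinder b m ∩ pathCylinder a n =
          pathCylinder c (n + m) := by
        ext ω
        simp only [pathCylinder, pathShift, Set.mem_inter_iff, Set.mem_preimage,
          Set.mem_ofPred_eq]
        constructor
        · rintro ⟨h1, h2⟩ i hi
          rcases le_total i n with h | h
          · rw [h2 i h, hca i h]
          · obtain ⟨j, rfl⟩ := Nat.exists_eq_add_of_le h
            rw [h1 j (by omega), hcb]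
        · intro h
          exact ⟨fun i hi => by rw [h _ (by omega), hcb],
            fun i hi => by rw [h i (by omega), hca i hi]⟩
      rw [hset, measure_pathCylinder, measure_pathCylinder, Finset.prod_range_add,
        if_pos hb, one_mul, mul_assoc, hca 0 (Nat.zero_le n)]
      congr 2
      · refine Finset.prod_congr rfl fun i hi => ?_
        have := Finset.mem_range.mp hi
        rw [hca i (by omega), hca (i + 1) (by omega)]
      · refine Finset.prod_congr rfl fun i _ => ?_
        rw [hcb, add_assoc, hcb]
    · rw [if_neg hb, zero_mul, mul_zero]
      convert measure_empty (μ := M.P x)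
      ext ω
      simp only [pathCylinder, pathShift, Set.mem_inter_iff, Set.mem_preimage,
        Set.mem_ofPred_eq, Set.mem_empty_iff_false, iff_false, not_and]
      intro h1 h2
      exact hb ((h1 0 (Nat.zero_le m)).symm.trans (h2 n le_rfl))
  have h := DFunLike.congr_fun hμ B
  rwa [Measure.map_apply (measurable_pathShift n) hB,
    Measure.restrict_apply (measurable_pathShift n hB), Set.inter_comm,
    Measure.smul_apply, smul_eq_mul] at h

/-- The Markov property at time `n`. -/
theorem measure_restrict_inter_shift (x y : E) (n : ℕ) {S : Set (Fin (n + 1) → E)}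
    (hS : ∀ xs ∈ S, xs (Fin.last n) = y) {B : Set (ℕ → E)} (hB : MeasurableSet B) :
    M.P x (pathRestrict n ⁻¹' S ∩ pathShift n ⁻¹' B) =
      M.P x (pathRestrict n ⁻¹' S) * M.P y B := by
  have hmeas : ∀ b : Fin (n + 1) → E, MeasurableSet (pathRestrict (E := E) n ⁻¹' {b}) :=
    fun b => measurable_pathRestrict n (measurableSet_singleton b)
  rw [← Measure.restrict_apply' (measurable_pathShift n hB),
    ← tsum_measure_preimage_singleton S.to_countable fun b _ => hmeas b,
    ← tsum_measure_preimage_singleton S.to_countable fun b _ => hmeas b,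
    ← ENNReal.tsum_mul_right]
  refine tsum_congr fun b => ?_
  obtain ⟨a, ha⟩ := exists_pathRestrict_eq n b.1
  have hy : a n = y := by
    rw [← hS b.1 b.2, ← ha]
    simp [pathRestrict]
  rw [Measure.restrict_apply' (measurable_pathShift n hB), ← ha,
    pathRestrict_preimage_singleton, M.measure_pathCylinder_inter_shift x a n hB, hy]

/-- Decomposition according to the first step. -/
theorem measure_shift_one (x : E) {B : Set (ℕ → E)} (hB : MeasurableSet B) :
    M.P x (pathShift 1 ⁻¹' B) = ∑' z, M.p x z * M.P z B := by
  have := M.prob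
  have hz : ∀ z : E, MeasurableSet ((fun ω : ℕ → E => ω 1) ⁻¹' {z}) :=
    fun z => measurable_pi_apply 1 (measurableSet_singleton z)
  have hae : ∀ s, M.P x s = M.P x (s ∩ {ω | ω 0 = x}) :=
    fun s => (measure_inter_conull (M.ae_eval_zero x)).symm
  rw [← Measure.restrict_apply_univ, ← Set.preimage_univ (f := fun ω : ℕ → E => ω 1),
    ← tsum_measure_preimage_singleton Set.countable_univ fun z _ => hz z,
    tsum_univ fun z => (M.P x).restrict (pathShift 1 ⁻¹' B) ((fun ω : ℕ → E => ω 1) ⁻¹' {z})]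
  refine tsum_congr fun z => ?_
  set a : ℕ → E := fun i => if i = 0 then x else z with ha
  have hset : (fun ω : ℕ → E => ω 1) ⁻¹' {z} ∩ pathShift 1 ⁻¹' B ∩ {ω | ω 0 = x} =
      pathCylinder a 1 ∩ pathShift 1 ⁻¹' B := by
    ext ω
    simp only [Set.mem_inter_iff, Set.mem_preimage, Set.mem_singleton_iff, Set.mem_ofPred_eq,
      pathCylinder, ha]
    constructor
    · rintro ⟨⟨h1, h2⟩, h0⟩
      refine ⟨fun i hi => ?_, h2⟩
      interval_cases i <;> simp [h0, h1]
    · rintro ⟨h, h2⟩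
      exact ⟨⟨by simpa using h 1 le_rfl, h2⟩, by simpa using h 0 zero_le_one⟩
  rw [Measure.restrict_apply (hz z), hae, hset, M.measure_pathCylinder_inter_shift x a 1 hB,
    measure_pathCylinder]
  simp [ha]

theorem measure_hitSet_of_ne {x y : E} (hxy : x ≠ y) :
    M.P x (hitSet y) = ∑' z, M.p x z * M.P z (hitSet y) := by
  have := M.prob
  rw [← M.measure_shift_one x (measurableSet_hitSet y)]
  refine measure_congr ?_
  filter_upwards [M.ae_eval_zero x] with ω hω
  refine propext ⟨?_, ?_⟩
  · rintro ⟨n, hn⟩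
    cases n with
    | zero => exact absurd (hω.symm.trans hn) hxy
    | succ n => exact ⟨n, by rwa [pathShift, add_comm]⟩
  · rintro ⟨n, hn⟩
    exact ⟨1 + n, hn⟩

/-- The strong Markov property at the first visit to `r`: one way of hitting `y` is to visit
`r` first. -/
theorem measure_hitSet_mul_le (x r y : E) :
    M.P x (hitSet r) * M.P r (hitSet y) ≤ M.P x (hitSet y) := by
  set S : (n : ℕ) → Set (Fin (n + 1) → E) :=
    fun n => {xs | xs (Fin.last n) = r ∧ ∀ i, i ≠ Fin.last n → xs i ≠ r} with hS
  have hmem : ∀ n (ω : ℕ → E), ω ∈ pathRestrict n ⁻¹' S n ↔ ω n = r ∧ ∀ i < n, ω i ≠ r := by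
    intro n ω
    simp only [hS, Set.mem_preimage, Set.mem_ofPred_eq, pathRestrict, Fin.val_last]
    refine and_congr_right fun _ => ⟨fun h i hi => h ⟨i, by omega⟩ ?_, fun h i hi => h i ?_⟩
    · simp only [ne_eq, Fin.ext_iff, Fin.val_last]
      omega
    · simp only [ne_eq, Fin.ext_iff, Fin.val_last] at hi
      omega
  have hdisj : Pairwise (Function.onFun Disjoint
      fun n => pathRestrict (E := E) n ⁻¹' S n) := by
    intro n m hnm
    refine Set.disjoint_left.mpr fun ω h1 h2 => ?_
    rw [hmem] at h1 h2
    rcases lt_or_gt_of_ne hnm with h | h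
    · exact h2.2 n h h1.1
    · exact h1.2 m h h2.1
  have hunion : hitSet r = ⋃ n, pathRestrict n ⁻¹' S n := by
    ext ω
    simp only [Set.mem_iUnion, hmem]
    constructor
    · intro h
      exact ⟨Nat.find h, Nat.find_spec h, fun i hi => Nat.find_min h hi⟩
    · rintro ⟨n, hn, -⟩
      exact ⟨n, hn⟩
  have hSm : ∀ n, MeasurableSet (pathRestrict (E := E) n ⁻¹' S n) :=
    fun n => measurable_pathRestrict n (Set.to_countable _).measurableSet
  have hH := measurableSet_hitSet (E := E) y
  calc M.P x (hitSet r) * M.P r (hitSet y)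
      = ∑' n, M.P x (pathRestrict n ⁻¹' S n ∩ pathShift n ⁻¹' hitSet y) := by
        rw [hunion, measure_iUnion hdisj hSm, ← ENNReal.tsum_mul_right]
        exact tsum_congr fun n =>
          (M.measure_restrict_inter_shift x r n (fun xs h => h.1) hH).symm
    _ = M.P x (⋃ n, pathRestrict n ⁻¹' S n ∩ pathShift n ⁻¹' hitSet y) :=
        (measure_iUnion (fun n m hnm => (hdisj hnm).mono Set.inter_subset_left
          Set.inter_subset_left) fun n => (hSm n).inter (measurable_pathShift n hH)).symm
    _ ≤ M.P x (hitSet y) := by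
        refine measure_mono (Set.iUnion_subset fun n => ?_)
        rintro ω ⟨-, m, hm⟩
        exact ⟨n + m, hm⟩

/-- The minimum principle: if `x ≠ y` minimizes the probability of hitting `y`, so does every
state reachable from `x` in one step. -/
theorem measure_hitSet_eq_of_min {x y z : E} (hxy : x ≠ y) (hxz : M.p x z ≠ 0)
    (hmin : ∀ w, M.P x (hitSet y) ≤ M.P w (hitSet y)) :
    M.P z (hitSet y) = M.P x (hitSet y) := by
  have := M.prob
  refine le_antisymm (not_lt.mp fun hlt => ?_) (hmin z)
  have hsum : ∑' w, M.p x w * M.P x (hitSet y) = M.P x (hitSet y) := by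
    rw [ENNReal.tsum_mul_right, M.stochastic, one_mul]
  have hp : M.p x z ≠ ⊤ :=
    ne_top_of_le_ne_top one_ne_top ((ENNReal.le_tsum z).trans_eq (M.stochastic x))
  have h : ∑' w, M.p x w * M.P x (hitSet y) < ∑' w, M.p x w * M.P w (hitSet y) := by
    refine ENNReal.tsum_lt_tsum (i := z) ?_ (fun w => mul_le_mul_right (hmin w) _) ?_
    · rw [hsum]
      exact measure_ne_top _ _
    · exact ENNReal.mul_lt_mul_right hxz hp hlt
  rw [hsum, ← M.measure_hitSet_of_ne hxy] at h
  exact lt_irrefl _ h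

/-- A state hit almost surely from every starting point is visited infinitely often. -/
theorem measure_visit_infinitely_often {y : E} (h : ∀ x, M.P x (hitSet y) = 1) (x : E) :
    M.P x {ω | ∀ N : ℕ, ∃ n, N ≤ n ∧ ω n = y} = 1 := by
  have := M.prob
  have hH := measurableSet_hitSet (E := E) y
  have hset : {ω : ℕ → E | ∀ N : ℕ, ∃ n, N ≤ n ∧ ω n = y} =
      ⋂ N, pathShift N ⁻¹' hitSet y := by
    ext ω
    simp only [Set.mem_ofPred_eq, Set.mem_iInter, Set.mem_preimage, hitSet, pathShift]
    refine forall_congr' fun N => ⟨?_, ?_⟩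
    · rintro ⟨n, hn, hω⟩
      exact ⟨n - N, by rwa [Nat.add_sub_cancel' hn]⟩
    · rintro ⟨m, hm⟩
      exact ⟨N + m, Nat.le_add_right _ _, hm⟩
  have hN : ∀ N, M.P x (pathShift N ⁻¹' hitSet y) = 1 := by
    intro N
    have hz : ∀ b ∈ Set.univ, MeasurableSet (pathRestrict (E := E) N ⁻¹' {b}) :=
      fun b _ => measurable_pathRestrict N (measurableSet_singleton b)
    rw [← Measure.restrict_apply_univ, ← Set.preimage_univ (f := pathRestrict (E := E) N),
      ← tsum_measure_preimage_singleton Set.countable_univ hz,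
      ← measure_univ (μ := M.P x), ← Set.preimage_univ (f := pathRestrict (E := E) N),
      ← tsum_measure_preimage_singleton Set.countable_univ hz]
    refine tsum_congr fun b => ?_
    rw [Measure.restrict_apply (hz b.1 trivial),
      M.measure_restrict_inter_shift x (b.1 (Fin.last N)) N (by simp) hH, h, mul_one]
  rw [hset, ← prob_compl_eq_zero_iff
    (MeasurableSet.iInter fun N => measurable_pathShift N hH), Set.compl_iInter,
    measure_iUnion_null_iff]
  exact fun N => (prob_compl_eq_zero_iff (measurable_pathShift N hH)).mpr (hN N)

/-- A function `f` of a Markov chain with `∑_{f z = m} p(y, z) = q(f y, m)` is itself a Markov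
chain, with transition probabilities `q`. -/
theorem map_eq_of_lumpable {F : Type*} [MeasurableSpace F] [Countable F]
    [MeasurableSingletonClass F] (R : MC F) (f : E → F)
    (hf : ∀ y m, ∑' z, (if f z = m then M.p y z else 0) = R.p (f y) m) (x : E) :
    Measure.map (fun ω n => f (ω n)) (M.P x) = R.P (f x) := by
  have := M.prob
  have hfm : Measurable f := measurable_of_countable f
  have hfm' : Measurable fun (ω : ℕ → E) n => f (ω n) :=
    measurable_pi_lambda _ fun n => hfm.comp (measurable_pi_apply n)
  have hprob : IsProbabilityMeasure (Measure.map (fun ω n => f (ω n)) (M.P x)) :=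
    Measure.isProbabilityMeasure_map hfm'.aemeasurable
  refine ext_of_pathCylinder fun b n => ?_
  rw [Measure.map_apply hfm' (measurableSet_pathCylinder b n), R.measure_pathCylinder]
  have hstep : ∀ y m, M.P y (pathShift 1 ⁻¹' {ω | f (ω 0) = m}) = R.p (f y) m := by
    intro y m
    have hBm : MeasurableSet {ω : ℕ → E | f (ω 0) = m} :=
      (hfm.comp (measurable_pi_apply 0)) (measurableSet_singleton m)
    rw [M.measure_shift_one y hBm, ← hf y m]
    refine tsum_congr fun z => ?_
    split_ifs with h
    · have : M.P z {ω | f (ω 0) = m} = 1 := by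
        refine (prob_compl_eq_zero_iff hBm).mp ?_
        filter_upwards [M.ae_eval_zero z] with ω hω
        simp [hω, h]
      rw [this, mul_one]
    · have : M.P z {ω | f (ω 0) = m} = 0 := by
        refine measure_eq_zero_iff_ae_notMem.mpr ?_
        filter_upwards [M.ae_eval_zero z] with ω hω
        simp [hω, h]
      rw [this, mul_zero]
  induction n with
  | zero =>
    simp only [Finset.range_zero, Finset.prod_empty, mul_one]
    split_ifs with h
    · refine (prob_compl_eq_zero_iff (hfm' (measurableSet_pathCylinder b 0))).mp ?_
      filter_upwards [M.ae_eval_zero x] with ω hω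
      simp [pathCylinder, hω, h]
    · refine measure_eq_zero_iff_ae_notMem.mpr ?_
      filter_upwards [M.ae_eval_zero x] with ω hω
      simp [pathCylinder, hω, Ne.symm h]
  | succ n ih =>
    rw [Finset.prod_range_succ, ← mul_assoc, ← ih]
    set A : Set (Fin (n + 1) → E) := {xs | ∀ i : Fin (n + 1), f (xs i) = b i} with hA
    set B : Set (ℕ → E) := pathShift 1 ⁻¹' {ω | f (ω 0) = b (n + 1)} with hBdef
    have hB : MeasurableSet B := measurable_pathShift 1
      ((hfm.comp (measurable_pi_apply 0)) (measurableSet_singleton (b (n + 1))))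
    have hn : (fun (ω : ℕ → E) n => f (ω n)) ⁻¹' pathCylinder b n = pathRestrict n ⁻¹' A := by
      ext ω
      simp only [Set.mem_preimage, pathCylinder, Set.mem_ofPred_eq, hA, pathRestrict]
      exact ⟨fun h i => h i (by omega), fun h i hi => h ⟨i, by omega⟩⟩
    have hsucc : (fun (ω : ℕ → E) n => f (ω n)) ⁻¹' pathCylinder b (n + 1) =
        pathRestrict n ⁻¹' A ∩ pathShift n ⁻¹' B := by
      rw [← hn]
      ext ω
      simp only [Set.mem_inter_iff, Set.mem_preimage, pathCylinder, Set.mem_ofPred_eq, hBdef,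
        pathShift, add_zero]
      refine ⟨fun h => ⟨fun i hi => h i (by omega), h _ le_rfl⟩, fun h i hi => ?_⟩
      rcases Nat.le_succ_iff.mp hi with hi | rfl
      · exact h.1 i hi
      · exact h.2
    have hz : ∀ b ∈ A, MeasurableSet (pathRestrict (E := E) n ⁻¹' {b}) :=
      fun b _ => measurable_pathRestrict n (measurableSet_singleton b)
    rw [hn, hsucc, ← Measure.restrict_apply' (measurable_pathShift n hB),
      ← tsum_measure_preimage_singleton A.to_countable hz,
      ← tsum_measure_preimage_singleton A.to_countable hz, ← ENNReal.tsum_mul_right]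
    refine tsum_congr fun c => ?_
    rw [Measure.restrict_apply (hz c.1 c.2),
      M.measure_restrict_inter_shift x (c.1 (Fin.last n)) n (by simp) hB, hBdef, hstep,
      c.2 (Fin.last n), Fin.val_last]

end General

/-- The reflected simple random walk hits `0` almost surely. -/
theorem measure_hitSet_zero_of_reflP (R : MC ℕ) (hpR : R.p = reflP) (m : ℕ) :
    R.P m (hitSet 0) = 1 := by
  have := R.prob
  set g : ℕ → ℝ := fun m => (R.P m).real (hitSet 0) with hg
  have hg0 : g 0 = 1 := by simp [hg, Measure.real, R.measure_hitSet_self]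
  have hg1 : ∀ m, g m ≤ 1 := fun m => measureReal_le_one
  have hgnn : ∀ m, 0 ≤ g m := fun m => measureReal_nonneg
  have hrec : ∀ m, g (m + 1) = (g m + g (m + 2)) / 2 := by
    intro m
    have h := R.measure_hitSet_of_ne (Nat.succ_ne_zero m)
    rw [hpR, tsum_eq_sum (s := {m, m + 2})] at h
    · rw [Finset.sum_pair (by omega)] at h
      simp only [reflP, Nat.succ_eq_add_one, if_neg (Nat.succ_ne_zero m), or_true, true_or,
        if_true] at h
      simp only [hg, Measure.real]
      rw [h, ENNReal.toReal_add (by finiteness) (by finiteness)]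
      simp
      ring
    · intro z hz
      simp only [Finset.mem_insert, Finset.mem_singleton, not_or] at hz
      rw [reflP, if_neg (Nat.succ_ne_zero m), if_neg (by omega), zero_mul]
  have hlin : ∀ m : ℕ, g m = 1 + m * (g 1 - 1) ∧ g (m + 1) = 1 + (m + 1) * (g 1 - 1) := by
    intro m
    induction m with
    | zero => simp [hg0]
    | succ m ih =>
      have := hrec m
      push_cast
      exact ⟨ih.2, by rw [show m + 1 + 1 = m + 2 from rfl]; linarith [ih.1, ih.2]⟩
  have hc : g 1 = 1 := by
    refine le_antisymm (hg1 1) (not_lt.mp fun hlt => ?_)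
    obtain ⟨N, hN⟩ := exists_nat_gt (1 / (1 - g 1))
    rw [div_lt_iff₀ (by linarith)] at hN
    linarith [hgnn N, (hlin N).1]
  have hgm : g m = 1 := by rw [(hlin m).1, hc]; ring
  exact (ENNReal.toReal_eq_one_iff _).mp hgm

end MC

instance {α : Type*} : MeasurableSingletonClass (List α) := ⟨fun _ => trivial⟩

theorem length_eq_of_treeP_ne_zero {k : ℕ} {x y : List (Fin k)} (hx : x ≠ [])
    (h : treeP k x y ≠ 0) : y.length + 1 = x.length ∨ y.length = x.length + 1 := by
  have := List.length_pos_of_ne_nil hx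
  rw [treeP, if_neg hx] at h
  split_ifs at h with h1 h2
  · left
    rw [h1, List.length_dropLast]
    omega
  · right
    obtain ⟨j, rfl⟩ := h2
    simp
  · exact absurd rfl h

/-- The length is a lumping of the tree walk onto the reflected walk. -/
theorem tsum_treeP_length_eq {k : ℕ} (hstoch : ∀ x, ∑' y, treeP k x y = 1)
    (x : List (Fin k)) (m : ℕ) :
    ∑' z, (if z.length = m then treeP k x z else 0) = reflP x.length m := by
  by_cases hx : x = []
  · subst hx
    by_cases hm : m = 1
    · subst hm
      simp only [reflP, List.length_nil, if_true]
      rw [← hstoch []]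
      refine tsum_congr fun z => ?_
      by_cases h : z.length = 1 <;> simp [treeP, h]
    · simp only [reflP, List.length_nil, if_true, if_neg hm, ENNReal.tsum_eq_zero]
      intro z
      by_cases h : z.length = m
      · simp [treeP, h, hm]
      · simp [h]
  · have hpos := List.length_pos_of_ne_nil hx
    have hdown : ∀ m, m + 1 = x.length →
        ∑' z, (if z.length = m then treeP k x z else 0) = 1 / 2 := by
      intro m hm
      rw [tsum_eq_single x.dropLast]
      · rw [if_pos (by rw [List.length_dropLast]; omega), treeP, if_neg hx, if_pos rfl]
      · intro z hz
        split_ifs with h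
        · rw [treeP, if_neg hx, if_neg hz, if_neg]
          rintro ⟨j, rfl⟩
          simp at h
          omega
        · rfl
    have hup : ∑' z, (if z.length = x.length + 1 then treeP k x z else 0) = 1 / 2 := by
      have hsum : ∑' z, (if z.length = x.length + 1 then treeP k x z else 0) + 1 / 2 = 1 := by
        rw [← hdown (x.length - 1) (by omega), ← ENNReal.tsum_add, ← hstoch x]
        refine tsum_congr fun z => ?_
        by_cases h0 : treeP k x z = 0
        · simp [h0]
        · rcases length_eq_of_treeP_ne_zero hx h0 with h | h
          · rw [if_neg (by omega), if_pos (by omega), zero_add]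
          · rw [if_pos h, if_neg (by omega), add_zero]
      refine (ENNReal.add_left_inj (show (1 / 2 : ℝ≥0∞) ≠ ⊤ by simp)).mp ?_
      rw [hsum, ENNReal.add_halves]
    rw [reflP, if_neg hpos.ne']
    split_ifs with h
    · rcases h with rfl | h
      · exact hup
      · exact hdown m h
    · rw [ENNReal.tsum_eq_zero]
      intro z
      split_ifs with hz
      · by_contra h0
        rcases length_eq_of_treeP_ne_zero hx h0 with h' | h' <;> omega
      · rfl

theorem treeP_take_ne_zero {k : ℕ} (y : List (Fin k)) {i : ℕ} (hi : i < y.length) :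
    treeP k (y.take i) (y.take (i + 1)) ≠ 0 := by
  have hlen : (y.take i).length = i := by simp [hi.le]
  have hlen' : (y.take (i + 1)).length = i + 1 := by simp; omega
  rw [treeP]
  split_ifs with h1 h2 h3 h4
  · simp
  · rw [h1] at hlen
    exact absurd (by rw [hlen', ← hlen]; rfl) h2
  · simp
  · simp [ENNReal.mul_eq_top]
  · exact absurd ⟨y[i], by simp⟩ h4

/-- On the infinite `k`-ary tree, the depth process (length of `X_n`) of the random walk
is a reflected simple symmetric random walk on `ℕ`; consequently the random walk on the
tree is recurrent (it visits every vertex infinitely often almost surely). -/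
theorem tree_depth_process_reflected_walk_and_recurrent
    (k : ℕ) (hk : 2 ≤ k) (M : MC (List (Fin k))) (hpM : M.p = treeP k)
    (R : MC ℕ) (hpR : R.p = reflP) :
    (∀ x : List (Fin k),
      Measure.map (fun (ω : ℕ → List (Fin k)) (n : ℕ) => (ω n).length) (M.P x)
        = R.P x.length) ∧
    (∀ x y : List (Fin k), M.P x {ω | ∀ N : ℕ, ∃ n, N ≤ n ∧ ω n = y} = 1) := by
  have hstoch : ∀ x, ∑' y, treeP k x y = 1 := hpM ▸ M.stochastic
  have hmap : ∀ x : List (Fin k),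
      Measure.map (fun (ω : ℕ → List (Fin k)) (n : ℕ) => (ω n).length) (M.P x)
        = R.P x.length := by
    refine M.map_eq_of_lumpable R List.length ?_
    intro y m
    rw [hpM, hpR, ← tsum_treeP_length_eq hstoch]
    congr!
  refine ⟨hmap, fun x y => M.measure_visit_infinitely_often (fun x => ?_) x⟩
  have := M.prob
  have hroot : ∀ x, M.P x (hitSet []) = 1 := by
    intro x
    rw [← R.measure_hitSet_zero_of_reflP hpR x.length, ← hmap x,
      Measure.map_apply _ (measurableSet_hitSet 0)]
    · congr 1
      ext ω
      simp [hitSet]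
    · exact measurable_pi_lambda _ fun n =>
        (measurable_of_countable List.length).comp (measurable_pi_apply n)
  have hmin : ∀ w, M.P [] (hitSet y) ≤ M.P w (hitSet y) := fun w => by
    simpa [hroot w] using M.measure_hitSet_mul_le w [] y
  have htake : ∀ i ≤ y.length, M.P (y.take i) (hitSet y) = M.P [] (hitSet y) := by
    intro i
    induction i with
    | zero => simp
    | succ i ih =>
      intro hi
      have hprev := ih (by omega)
      rw [← hprev]
      refine M.measure_hitSet_eq_of_min ?_ ?_ fun w => hprev ▸ hmin w
      · intro h
        have := congrArg List.length h
        rw [List.length_take] at this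
        omega
      · rw [hpM]
        exact treeP_take_ne_zero y hi
  have hone : M.P [] (hitSet y) = 1 := by
    rw [← htake _ le_rfl, List.take_length, M.measure_hitSet_self]
  exact le_antisymm prob_le_one (hone ▸ hmin x)
end
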